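/- Let φ : ℂ → ℂ be an entire function with φ(0) = 0 and let m > 1/2. Then there exists an entire function φ_m : ℂ → ℂ which is real-valued and monotonically increasing on [0,∞) with φ_m(0) = 0, such that for every σ ≥ 0 and every u ∈ G^m_σ, the composition φ∘u lies in G^m_σ and ‖φ(u)‖_{G^m_σ} ≤ φ_m(‖u‖_{G^m_σ}). -/

import Mathlib

open MeasureTheory

noncomputable def fHat {E : Type*} [NormedAddCommGroup E] [NormedSpace ℂ E]
    (u : ℝ → E) (k : ℝ) : E :=
  (Real.sqrt (2 * Real.pi))⁻¹ • ∫ x : ℝ, Complex.exp (-(Complex.I * k * x)) • u x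

noncomputable def gevreyWeight (m σ k : ℝ) : ℝ :=
  Real.exp (2 * σ * (1 + |k|)) * (1 + k ^ 2) ^ m

def MemGevrey {E : Type*} [NormedAddCommGroup E] [NormedSpace ℂ E]
    (m σ : ℝ) (u : ℝ → E) : Prop :=
  Integrable u ∧ Integrable (fun k => gevreyWeight m σ k * ‖fHat u k‖ ^ 2)

noncomputable def gevreyNorm {E : Type*} [NormedAddCommGroup E] [NormedSpace ℂ E]
    (m σ : ℝ) (u : ℝ → E) : ℝ :=
  Real.sqrt (∫ k : ℝ, gevreyWeight m σ k * ‖fHat u k‖ ^ 2)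

def GevreyContOn {E : Type*} [NormedAddCommGroup E] [NormedSpace ℂ E]
    (m σ : ℝ) (u : ℝ → ℝ → E) (s : Set ℝ) : Prop :=
  (∀ t ∈ s, MemGevrey m σ (u t)) ∧
  ∀ t ∈ s, Filter.Tendsto (fun t' => gevreyNorm m σ (fun x => u t' x - u t x))
      (nhdsWithin t s) (nhds 0)

def GevreyC1On {E : Type*} [NormedAddCommGroup E] [NormedSpace ℂ E]
    (m σ : ℝ) (u : ℝ → ℝ → E) (s : Set ℝ) : Prop :=
  ∃ v : ℝ → ℝ → E,
    (∀ t ∈ s, Filter.Tendsto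
      (fun t' => gevreyNorm m σ (fun x => (t' - t)⁻¹ • (u t' x - u t x) - v t x))
      (nhdsWithin t (s \ {t})) (nhds 0)) ∧
    GevreyContOn m σ v s

open scoped FourierTransform ENNReal

theorem MeasureTheory.Integrable.fourierInv_fourier_ae_eq {v : ℝ → ℂ} (hv : Integrable v)
    (hv' : Integrable (𝓕 v)) : 𝓕⁻ (𝓕 v) =ᵐ[volume] v := by
  have hcont : Continuous (𝓕⁻ (𝓕 v)) := by
    rw [Real.fourierInv_eq_fourier_comp_neg]
    exact VectorFourier.fourierIntegral_continuous Real.continuous_fourierChar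
      continuous_inner hv'.comp_neg
  refine ae_eq_of_integral_contDiff_smul_eq hcont.locallyIntegrable hv.locallyIntegrable ?_
  intro g g_smooth g_cpt
  have hg₁ : HasCompactSupport (Complex.ofRealCLM ∘ g) := g_cpt.comp_left rfl
  have hg₂ : ContDiff ℝ (⊤ : ℕ∞) (Complex.ofRealCLM ∘ g) := by fun_prop
  let G : SchwartzMap ℝ ℂ := hg₁.toSchwartzMap hg₂
  have flip (a b : ℝ → ℂ) (ha : Integrable a) (hb : Integrable b) :
      ∫ x, 𝓕 a x * b x = ∫ x, a x * 𝓕 b x := by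
    simpa using! VectorFourier.integral_fourierIntegral_smul_eq_flip (L := innerₗ ℝ)
      Real.continuous_fourierChar continuous_inner ha hb
  have hGi : Integrable (G : ℝ → ℂ) := G.integrable
  have e : ∀ w : ℝ → ℂ, ∫ x, g x • w x = ∫ x, w x * G x := by
    intro w
    congr with x
    simp [G, mul_comm]
  have hinv : 𝓕 (𝓕⁻ (G : ℝ → ℂ)) = G := by
    rw [← SchwartzMap.fourierInv_coe, ← SchwartzMap.fourier_coe]
    simp
  have hGi' : Integrable (𝓕⁻ (G : ℝ → ℂ)) := by
    rw [← SchwartzMap.fourierInv_coe]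
    exact (𝓕⁻ G).integrable
  rw [e, e]
  calc ∫ x, 𝓕⁻ (𝓕 v) x * G x = ∫ x, 𝓕 (𝓕 v) x * G (-x) := by
        rw [← integral_neg_eq_self]
        simp [Real.fourierInv_eq_fourier_neg]
    _ = ∫ x, 𝓕 v x * 𝓕 (fun y => G (-y)) x := flip _ _ hv' hGi.comp_neg
    _ = ∫ x, 𝓕 v x * 𝓕⁻ (G : ℝ → ℂ) x := by
        rw [Real.fourierInv_eq_fourier_comp_neg]
    _ = ∫ x, v x * 𝓕 (𝓕⁻ (G : ℝ → ℂ)) x := flip _ _ hv hGi'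
    _ = ∫ x, v x * G x := by rw [hinv]

theorem fHat_eq_fourier (u : ℝ → ℂ) (k : ℝ) :
    fHat u k = ((Real.sqrt (2 * Real.pi))⁻¹ : ℝ) • 𝓕 u (k / (2 * Real.pi)) := by
  rw [fHat, Real.fourier_real_eq_integral_exp_smul]
  congr 2 with x
  congr 2
  push_cast
  field_simp

theorem continuous_fHat {u : ℝ → ℂ} (hu : Integrable u) : Continuous (fHat u) := by
  have : Continuous (𝓕 u) := VectorFourier.fourierIntegral_continuous
    Real.continuous_fourierChar continuous_inner hu
  have h : fHat u = fun k => ((Real.sqrt (2 * Real.pi))⁻¹ : ℝ) • 𝓕 u (k / (2 * Real.pi)) :=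
    funext (fHat_eq_fourier u)
  rw [h]
  fun_prop

theorem ae_eq_integral_fHat {v : ℝ → ℂ} (hv : Integrable v) (hv' : Integrable (fHat v)) :
    ∀ᵐ x, v x = ((Real.sqrt (2 * Real.pi))⁻¹ : ℝ) •
      ∫ l : ℝ, Complex.exp (Complex.I * l * x) • fHat v l := by
  have hpi : (0 : ℝ) < 2 * Real.pi := by positivity
  have hs : Real.sqrt (2 * Real.pi) ≠ 0 := by positivity
  have hF : ∀ k, 𝓕 v k = (Real.sqrt (2 * Real.pi) : ℝ) • fHat v (2 * Real.pi * k) := by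
    intro k
    rw [fHat_eq_fourier, smul_smul, mul_inv_cancel₀ hs, one_smul]
    field_simp
  have hFi : Integrable (𝓕 v) := by
    rw [show 𝓕 v = fun k => (Real.sqrt (2 * Real.pi) : ℝ) • fHat v (2 * Real.pi * k) from funext hF]
    exact (hv'.comp_mul_left' hpi.ne').smul (Real.sqrt (2 * Real.pi))
  filter_upwards [hv.fourierInv_fourier_ae_eq hFi] with x hx
  rw [← hx, Real.fourierInv_eq']
  simp_rw [hF]
  have := Measure.integral_comp_mul_left
    (fun l : ℝ => Complex.exp (Complex.I * l * x) • fHat v l) (2 * Real.pi)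
  have h2 : ∫ l : ℝ, Complex.exp (Complex.I * l * x) • fHat v l =
      (2 * Real.pi) • ∫ y : ℝ, Complex.exp (Complex.I * ((2 * Real.pi * y : ℝ) : ℂ) * x) •
        fHat v (2 * Real.pi * y) := by
    rw [this, smul_smul, abs_of_pos (by positivity), mul_inv_cancel₀ hpi.ne', one_smul]
  rw [h2, smul_smul, ← integral_smul]
  congr 1 with y
  have h3 : (Real.sqrt (2 * Real.pi))⁻¹ * (2 * Real.pi) = Real.sqrt (2 * Real.pi) := by
    rw [inv_mul_eq_div, Real.div_sqrt]
  rw [h3, smul_comm]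
  congr 3
  simp
  ring

theorem norm_le_integral_norm_fHat {v : ℝ → ℂ} (hv : Integrable v) (hv' : Integrable (fHat v)) :
    ∀ᵐ x, ‖v x‖ ≤ (Real.sqrt (2 * Real.pi))⁻¹ * ∫ l : ℝ, ‖fHat v l‖ := by
  filter_upwards [ae_eq_integral_fHat hv hv'] with x hx
  rw [hx, norm_smul, Real.norm_of_nonneg (by positivity)]
  gcongr
  refine (norm_integral_le_integral_norm _).trans_eq ?_
  congr with l
  rw [norm_smul, show Complex.I * l * x = ((l * x : ℝ) : ℂ) * Complex.I by push_cast; ring,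
    Complex.norm_exp_ofReal_mul_I, one_mul]

theorem fHat_mul {u v : ℝ → ℂ} (hu : Integrable u) (hv : Integrable v)
    (hv' : Integrable (fHat v)) (k : ℝ) :
    fHat (fun x => u x * v x) k =
      ((Real.sqrt (2 * Real.pi))⁻¹ : ℝ) • ∫ l : ℝ, fHat u (k - l) * fHat v l := by
  have h1 : ∫ x : ℝ, Complex.exp (-(Complex.I * k * x)) • (u x * v x) =
      ∫ x : ℝ, ((Real.sqrt (2 * Real.pi))⁻¹ : ℝ) • ∫ l : ℝ,
        Complex.exp (-(Complex.I * (k - l : ℝ) * x)) * (u x * fHat v l) := by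
    apply integral_congr_ae
    filter_upwards [ae_eq_integral_fHat hv hv'] with x hx
    conv_lhs => rw [hx]
    rw [mul_smul_comm, smul_comm]
    congr 1
    rw [smul_eq_mul, ← mul_assoc, ← integral_const_mul]
    congr with l
    rw [smul_eq_mul, show -(Complex.I * ((k - l : ℝ) : ℂ) * x) =
      -(Complex.I * k * x) + Complex.I * l * x by push_cast; ring, Complex.exp_add]
    ring
  rw [fHat, h1]
  congr 1
  rw [integral_smul, integral_integral_swap, ← integral_smul]
  · congr with l
    rw [fHat.eq_def u, smul_mul_assoc]
    congr 1
    rw [← integral_mul_const]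
    congr with x
    rw [smul_eq_mul]
    ring
  · have := hu.mul_prod hv'
    refine this.bdd_mul (c := 1)  (Continuous.aestronglyMeasurable (by fun_prop)) ?_
    filter_upwards with p
    rw [show -(Complex.I * ((k - p.2 : ℝ) : ℂ) * p.1) =
      ((-((k - p.2) * p.1) : ℝ) : ℂ) * Complex.I by push_cast; ring,
      Complex.norm_exp_ofReal_mul_I]

theorem ENNReal.sq_lintegral_mul_le {α : Type*} [MeasurableSpace α] (μ : Measure α)
    {f g : α → ℝ≥0∞} (hf : AEMeasurable f μ) (hg : AEMeasurable g μ) :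
    (∫⁻ a, f a * g a ∂μ) ^ 2 ≤ (∫⁻ a, f a ^ 2 ∂μ) * ∫⁻ a, g a ^ 2 ∂μ := by
  have h := ENNReal.lintegral_mul_le_Lp_mul_Lq μ Real.HolderConjugate.two_two hf hg
  simp only [Pi.mul_apply, ENNReal.rpow_two] at h
  calc _ ≤ ((∫⁻ a, f a ^ 2 ∂μ) ^ (1 / 2 : ℝ) * (∫⁻ a, g a ^ 2 ∂μ) ^ (1 / 2 : ℝ)) ^ 2 := by gcongr
    _ = _ := by
      rw [mul_pow, ← ENNReal.rpow_mul_natCast, ← ENNReal.rpow_mul_natCast]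
      norm_num

theorem gevreyWeight_pos (m σ k : ℝ) : 0 < gevreyWeight m σ k := by
  unfold gevreyWeight
  positivity

theorem continuous_gevreyWeight (m σ : ℝ) : Continuous (gevreyWeight m σ) := by
  unfold gevreyWeight
  refine Continuous.mul (by fun_prop) (Continuous.rpow_const (by fun_prop) fun k => .inl ?_)
  positivity

theorem one_add_sq_rpow_le_gevreyWeight {m σ : ℝ} (hσ : 0 ≤ σ) (k : ℝ) :
    (1 + k ^ 2) ^ m ≤ gevreyWeight m σ k := by
  unfold gevreyWeight
  exact le_mul_of_one_le_left (by positivity) (Real.one_le_exp (by positivity))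

theorem integrable_one_add_sq_rpow_neg {m : ℝ} (hm : 1 / 2 < m) :
    Integrable (fun k : ℝ => (1 + k ^ 2) ^ (-m)) := by
  have := integrable_rpow_neg_one_add_norm_sq (E := ℝ) (μ := volume) (r := 2 * m)
    (by simp; linarith)
  convert this using 3
  · simp
  · ring

theorem gevreyWeight_div_le {m σ : ℝ} (hm : 0 ≤ m) (hσ : 0 ≤ σ) (k l : ℝ) :
    gevreyWeight m σ k * (1 / (gevreyWeight m σ (k - l) * gevreyWeight m σ l)) ≤
      4 ^ m * ((1 + (k - l) ^ 2) ^ (-m) + (1 + l ^ 2) ^ (-m)) := by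
  rw [mul_one_div, div_le_iff₀ (mul_pos (gevreyWeight_pos ..) (gevreyWeight_pos ..))]
  have hexp : Real.exp (2 * σ * (1 + |k|)) ≤
      Real.exp (2 * σ * (1 + |k - l|)) * Real.exp (2 * σ * (1 + |l|)) := by
    rw [← Real.exp_add]
    gcongr
    have : |k| ≤ |k - l| + |l| := by simpa using abs_add_le (k - l) l
    nlinarith
  have hpow : (1 + k ^ 2) ^ m ≤ 4 ^ m * ((1 + (k - l) ^ 2) ^ m + (1 + l ^ 2) ^ m) := by
    rw [mul_add, ← Real.mul_rpow (by positivity) (by positivity),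
      ← Real.mul_rpow (by positivity) (by positivity)]
    rcases le_total ((k - l) ^ 2) (l ^ 2) with h | h
    · have : (1 + k ^ 2) ^ m ≤ (4 * (1 + l ^ 2)) ^ m := by
        gcongr
        nlinarith [sq_nonneg (k - l - l)]
      exact this.trans (le_add_of_nonneg_left (by positivity))
    · have : (1 + k ^ 2) ^ m ≤ (4 * (1 + (k - l) ^ 2)) ^ m := by
        gcongr
        nlinarith [sq_nonneg (k - l - l)]
      exact this.trans (le_add_of_nonneg_right (by positivity))
  unfold gevreyWeight
  set A := Real.exp (2 * σ * (1 + |k - l|))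
  set B := Real.exp (2 * σ * (1 + |l|))
  have ha : (0 : ℝ) < 1 + (k - l) ^ 2 := by positivity
  have hb : (0 : ℝ) < 1 + l ^ 2 := by positivity
  rw [Real.rpow_neg ha.le, Real.rpow_neg hb.le]
  have ha' := Real.rpow_pos_of_pos ha m
  have hb' := Real.rpow_pos_of_pos hb m
  generalize (1 + (k - l) ^ 2) ^ m = a at *
  generalize (1 + l ^ 2) ^ m = b at *
  calc _ ≤ (A * B) * (4 ^ m * (a + b)) := by gcongr
    _ = _ := by field_simp; ring

/-- The squared Gevrey norm as a lower Lebesgue integral. -/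
noncomputable def gevreyEnergy (m σ : ℝ) (u : ℝ → ℂ) : ℝ≥0∞ :=
  ∫⁻ k : ℝ, ENNReal.ofReal (gevreyWeight m σ k * ‖fHat u k‖ ^ 2)

theorem memGevrey_iff {m σ : ℝ} {u : ℝ → ℂ} :
    MemGevrey m σ u ↔ Integrable u ∧ gevreyEnergy m σ u < ∞ := by
  refine and_congr_right fun hu => ?_
  have hc : Continuous fun k => gevreyWeight m σ k * ‖fHat u k‖ ^ 2 :=
    (continuous_gevreyWeight m σ).mul ((continuous_fHat hu).norm.pow 2)
  rw [Integrable, hasFiniteIntegral_iff_ofReal]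
  · exact and_iff_right hc.aestronglyMeasurable
  · exact .of_forall fun k => mul_nonneg (gevreyWeight_pos m σ k).le (sq_nonneg _)

theorem gevreyNorm_eq_sqrt_toReal {m σ : ℝ} {u : ℝ → ℂ} (hu : Integrable u) :
    gevreyNorm m σ u = Real.sqrt (gevreyEnergy m σ u).toReal := by
  have hc : Continuous fun k => gevreyWeight m σ k * ‖fHat u k‖ ^ 2 :=
    (continuous_gevreyWeight m σ).mul ((continuous_fHat hu).norm.pow 2)
  rw [gevreyNorm, integral_eq_lintegral_of_nonneg_ae _ hc.aestronglyMeasurable, gevreyEnergy]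
  exact .of_forall fun k => mul_nonneg (gevreyWeight_pos m σ k).le (sq_nonneg _)

theorem MemGevrey.integrable_fHat {m σ : ℝ} (hm : 1 / 2 < m) (hσ : 0 ≤ σ) {u : ℝ → ℂ}
    (hu : MemGevrey m σ u) : Integrable (fHat u) := by
  refine (hu.2.add (integrable_one_add_sq_rpow_neg hm)).mono'
    (continuous_fHat hu.1).aestronglyMeasurable (.of_forall fun k => ?_)
  have hw := one_add_sq_rpow_le_gevreyWeight (m := m) hσ k
  have hk : (0 : ℝ) < 1 + k ^ 2 := by positivity
  rw [Pi.add_apply, Real.rpow_neg hk.le]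
  have hp := Real.rpow_pos_of_pos hk m
  generalize (1 + k ^ 2) ^ m = p at *
  generalize gevreyWeight m σ k = w at *
  have h0 := norm_nonneg (fHat u k)
  generalize ‖fHat u k‖ = x at *
  have h1 : 2 * x ≤ p * x ^ 2 + p⁻¹ := by
    have : p * x ^ 2 + p⁻¹ - 2 * x = p⁻¹ * (p * x - 1) ^ 2 := by field_simp; ring
    have : 0 ≤ p⁻¹ * (p * x - 1) ^ 2 := by positivity
    linarith
  have h2 : p * x ^ 2 ≤ w * x ^ 2 := by gcongr
  linarith

theorem gevreyEnergy_mul_le {m σ : ℝ} (hm : 1 / 2 < m) (hσ : 0 ≤ σ) {u v : ℝ → ℂ}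
    (hu : MemGevrey m σ u) (hv : MemGevrey m σ v) :
    gevreyEnergy m σ (fun x => u x * v x) ≤
      ENNReal.ofReal (2 * 4 ^ m * ∫ l : ℝ, (1 + l ^ 2) ^ (-m)) *
        (gevreyEnergy m σ u * gevreyEnergy m σ v) := by
  have hcu := continuous_fHat hu.1
  have hcv := continuous_fHat hv.1
  have hw := continuous_gevreyWeight m σ
  have hw0 := fun k => (gevreyWeight_pos m σ k)
  set F : ℝ → ℝ≥0∞ := fun k => ENNReal.ofReal (gevreyWeight m σ k * ‖fHat u k‖ ^ 2) with hF
  set G : ℝ → ℝ≥0∞ := fun k => ENNReal.ofReal (gevreyWeight m σ k * ‖fHat v k‖ ^ 2) with hG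
  have hFm : Measurable F := by fun_prop
  have hGm : Measurable G := by fun_prop
  set C : ℝ≥0∞ := ENNReal.ofReal (2 * 4 ^ m * ∫ l : ℝ, (1 + l ^ 2) ^ (-m)) with hC
  have hker (k : ℝ) : ENNReal.ofReal (gevreyWeight m σ k) *
      ∫⁻ l, ENNReal.ofReal (1 / (gevreyWeight m σ (k - l) * gevreyWeight m σ l)) ≤ C := by
    rw [← lintegral_const_mul' _ _ ENNReal.ofReal_ne_top]
    have hJ := integrable_one_add_sq_rpow_neg hm
    have hJ' := hJ.comp_sub_left k
    calc _ ≤ ∫⁻ l : ℝ, ENNReal.ofReal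
          (4 ^ m * ((1 + (k - l) ^ 2) ^ (-m) + (1 + l ^ 2) ^ (-m))) := by
          gcongr with l
          rw [← ENNReal.ofReal_mul (hw0 k).le]
          exact ENNReal.ofReal_le_ofReal (gevreyWeight_div_le (by linarith) hσ k l)
      _ = C := by
          have hi : Integrable fun l : ℝ =>
              4 ^ m * ((1 + (k - l) ^ 2) ^ (-m) + (1 + l ^ 2) ^ (-m)) := (hJ'.add hJ).const_mul _
          rw [← ofReal_integral_eq_lintegral_ofReal hi (.of_forall fun l => by dsimp; positivity), integral_const_mul, integral_add hJ' hJ,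
            integral_sub_left_eq_self (fun l : ℝ => (1 + l ^ 2) ^ (-m)) volume k, hC]
          congr 1
          ring
  have hpt (k : ℝ) : ENNReal.ofReal (gevreyWeight m σ k * ‖fHat (fun x => u x * v x) k‖ ^ 2) ≤
      C * ∫⁻ l, F (k - l) * G l := by
    have h1 : ‖fHat (fun x => u x * v x) k‖ₑ ≤ ∫⁻ l, ‖fHat u (k - l) * fHat v l‖ₑ := by
      rw [fHat_mul hu.1 hv.1 (hv.integrable_fHat hm hσ), enorm_smul]
      refine (mul_le_of_le_one_left' ?_).trans (enorm_integral_le_lintegral_enorm _)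
      rw [Real.enorm_of_nonneg (by positivity)]
      refine ENNReal.ofReal_le_one.2 (inv_le_one_of_one_le₀ (Real.one_le_sqrt.2 ?_))
      linarith [Real.pi_gt_three]
    have h2 : (∫⁻ l, ‖fHat u (k - l) * fHat v l‖ₑ) ^ 2 ≤ (∫⁻ l, F (k - l) * G l) *
        ∫⁻ l, ENNReal.ofReal (1 / (gevreyWeight m σ (k - l) * gevreyWeight m σ l)) := by
      set p : ℝ → ℝ := fun l => Real.sqrt (gevreyWeight m σ (k - l) * gevreyWeight m σ l) with hp
      have hp0 : ∀ l, 0 < p l := fun l => Real.sqrt_pos.2 (mul_pos (hw0 _) (hw0 _))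
      have hpc : Continuous p := by fun_prop
      have := ENNReal.sq_lintegral_mul_le volume
        (f := fun l => ENNReal.ofReal (p l * (‖fHat u (k - l)‖ * ‖fHat v l‖)))
        (g := fun l => ENNReal.ofReal (p l)⁻¹) (by fun_prop) (by fun_prop)
      refine le_trans (le_of_eq ?_) (this.trans (le_of_eq ?_))
      · congr 2 with l
        rw [← ENNReal.ofReal_mul (by have := hp0 l; positivity), ← ofReal_norm, norm_mul]
        congr 1
        have := (hp0 l).ne'
        field_simp
      · congr 1
        · congr with l
          rw [hF, hG, ← ENNReal.ofReal_mul (by have := hw0 (k - l); positivity),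
            ← ENNReal.ofReal_pow (by have := hp0 l; positivity), mul_pow,
            Real.sq_sqrt (mul_pos (hw0 _) (hw0 _)).le]
          congr 1
          ring
        · congr with l
          rw [← ENNReal.ofReal_pow (by have := hp0 l; positivity), inv_pow,
            Real.sq_sqrt (mul_pos (hw0 _) (hw0 _)).le, one_div]
    rw [ENNReal.ofReal_mul (hw0 k).le, ENNReal.ofReal_pow (norm_nonneg _), ofReal_norm]
    calc _ ≤ ENNReal.ofReal (gevreyWeight m σ k) * ((∫⁻ l, F (k - l) * G l) *
        ∫⁻ l, ENNReal.ofReal (1 / (gevreyWeight m σ (k - l) * gevreyWeight m σ l))) := by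
          gcongr
          exact le_trans (by gcongr) h2
      _ = (ENNReal.ofReal (gevreyWeight m σ k) *
          ∫⁻ l, ENNReal.ofReal (1 / (gevreyWeight m σ (k - l) * gevreyWeight m σ l))) *
            ∫⁻ l, F (k - l) * G l := by ring
      _ ≤ _ := by gcongr; exact hker k
  have hCt : C ≠ ∞ := ENNReal.ofReal_ne_top
  calc _ ≤ ∫⁻ k, C * ∫⁻ l, F (k - l) * G l := lintegral_mono hpt
    _ = C * ∫⁻ l, ∫⁻ k, F (k - l) * G l := by
      rw [lintegral_const_mul' _ _ hCt, lintegral_lintegral_swap]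
      exact Measurable.aemeasurable (by fun_prop)
    _ = C * ∫⁻ l, (∫⁻ k, F k) * G l := by
      congr 2 with l
      rw [lintegral_mul_const _ (by fun_prop), lintegral_sub_right_eq_self F l]
    _ = _ := by
      rw [lintegral_const_mul _ hGm]
      rfl

theorem MemGevrey.mul {m : ℝ} (hm : 1 / 2 < m) : ∃ K : ℝ, 1 ≤ K ∧
    ∀ σ : ℝ, 0 ≤ σ → ∀ u v : ℝ → ℂ, MemGevrey m σ u → MemGevrey m σ v →
      MemGevrey m σ (fun x => u x * v x) ∧
      gevreyNorm m σ (fun x => u x * v x) ≤ K * (gevreyNorm m σ u * gevreyNorm m σ v) := by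
  have hc : 0 ≤ 2 * 4 ^ m * ∫ l : ℝ, (1 + l ^ 2) ^ (-m) :=
    mul_nonneg (by positivity) (integral_nonneg fun l => by positivity)
  set c : ℝ := 2 * 4 ^ m * ∫ l : ℝ, (1 + l ^ 2) ^ (-m) with hcdef
  refine ⟨1 + c, by linarith, fun σ hσ u v hu hv => ?_⟩
  have hint : Integrable fun x => u x * v x :=
    hu.1.mul_bdd (hv.1.aestronglyMeasurable)
      (norm_le_integral_norm_fHat hv.1 (hv.integrable_fHat hm hσ))
  have hE := gevreyEnergy_mul_le hm hσ hu hv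
  have hu' := (memGevrey_iff.1 hu).2
  have hv' := (memGevrey_iff.1 hv).2
  have hfin : ENNReal.ofReal c * (gevreyEnergy m σ u * gevreyEnergy m σ v) < ∞ :=
    ENNReal.mul_lt_top ENNReal.ofReal_lt_top (ENNReal.mul_lt_top hu' hv')
  refine ⟨memGevrey_iff.2 ⟨hint, hE.trans_lt hfin⟩, ?_⟩
  rw [gevreyNorm_eq_sqrt_toReal hint, gevreyNorm_eq_sqrt_toReal hu.1,
    gevreyNorm_eq_sqrt_toReal hv.1, ← Real.sqrt_mul ENNReal.toReal_nonneg]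
  have hreal := ENNReal.toReal_mono hfin.ne hE
  rw [ENNReal.toReal_mul, ENNReal.toReal_mul, ENNReal.toReal_ofReal hc] at hreal
  set a := (gevreyEnergy m σ u).toReal * (gevreyEnergy m σ v).toReal
  have ha : 0 ≤ a := by positivity
  refine Real.sqrt_le_iff.2 ⟨by positivity, hreal.trans ?_⟩
  rw [mul_pow, Real.sq_sqrt ha]
  gcongr
  nlinarith

theorem MemGevrey.pow {m : ℝ} (hm : 1 / 2 < m) : ∃ K : ℝ, 1 ≤ K ∧
    ∀ σ : ℝ, 0 ≤ σ → ∀ u : ℝ → ℂ, MemGevrey m σ u → ∀ n : ℕ,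
      MemGevrey m σ (fun x => u x ^ (n + 1)) ∧
      gevreyNorm m σ (fun x => u x ^ (n + 1)) ≤ K ^ n * gevreyNorm m σ u ^ (n + 1) := by
  obtain ⟨K, hK, h⟩ := MemGevrey.mul hm
  refine ⟨K, hK, fun σ hσ u hu n => ?_⟩
  induction n with
  | zero => simpa using hu
  | succ n ih =>
    obtain ⟨h1, h2⟩ := h σ hσ _ _ ih.1 hu
    simp_rw [pow_succ _ (n + 1)]
    refine ⟨h1, h2.trans ?_⟩
    calc _ ≤ K * (K ^ n * gevreyNorm m σ u ^ (n + 1) * gevreyNorm m σ u) := by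
          gcongr
          · exact Real.sqrt_nonneg _
          · exact ih.2
      _ = _ := by ring

theorem fHat_const_mul (c : ℂ) (u : ℝ → ℂ) (k : ℝ) :
    fHat (fun x => c * u x) k = c * fHat u k := by
  simp_rw [fHat, smul_eq_mul, mul_left_comm _ c, integral_const_mul, mul_smul_comm]

theorem MemGevrey.const_mul {m σ : ℝ} {u : ℝ → ℂ} (hu : MemGevrey m σ u) (c : ℂ) :
    MemGevrey m σ (fun x => c * u x) := by
  refine ⟨hu.1.const_mul c, ?_⟩
  simp_rw [fHat_const_mul, norm_mul, mul_pow, mul_left_comm _ (‖c‖ ^ 2)]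
  exact hu.2.const_mul _

theorem gevreyNorm_const_mul (m σ : ℝ) (c : ℂ) (u : ℝ → ℂ) :
    gevreyNorm m σ (fun x => c * u x) = ‖c‖ * gevreyNorm m σ u := by
  simp_rw [gevreyNorm, fHat_const_mul, norm_mul, mul_pow, mul_left_comm _ (‖c‖ ^ 2),
    integral_const_mul]
  rw [Real.sqrt_mul (by positivity), Real.sqrt_sq (norm_nonneg c)]

theorem gevreyEnergy_eq_eLpNorm_sq (m σ : ℝ) (u : ℝ → ℂ) :
    gevreyEnergy m σ u =
      eLpNorm (fun k => Real.sqrt (gevreyWeight m σ k) • fHat u k) 2 volume ^ 2 := by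
  rw [← ENNReal.rpow_natCast, ← ENNReal.coe_ofNat, Nat.cast_ofNat]
  have h := eLpNorm_nnreal_pow_eq_lintegral (μ := volume) (p := 2)
    (f := fun k => Real.sqrt (gevreyWeight m σ k) • fHat u k) two_ne_zero
  refine Eq.trans ?_ h.symm
  refine lintegral_congr fun k => ?_
  have hw := gevreyWeight_pos m σ k
  rw [← ofReal_norm, norm_smul, Real.norm_of_nonneg (Real.sqrt_nonneg _),
    ENNReal.ofReal_rpow_of_nonneg (by positivity) (by positivity)]
  simp [mul_pow, Real.sq_sqrt hw.le]

theorem MemGevrey.eLpNorm_eq {m σ : ℝ} {u : ℝ → ℂ} (hu : MemGevrey m σ u) :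
    eLpNorm (fun k => Real.sqrt (gevreyWeight m σ k) • fHat u k) 2 volume =
      ENNReal.ofReal (gevreyNorm m σ u) := by
  have h := (memGevrey_iff.1 hu).2
  rw [gevreyNorm_eq_sqrt_toReal hu.1]
  rw [gevreyEnergy_eq_eLpNorm_sq] at h ⊢
  have hne : eLpNorm (fun k => Real.sqrt (gevreyWeight m σ k) • fHat u k) 2 volume ≠ ∞ := by
    intro h'
    exact absurd h (by rw [h']; simp)
  rw [ENNReal.toReal_pow, Real.sqrt_sq ENNReal.toReal_nonneg, ENNReal.ofReal_toReal hne]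

theorem memGevrey_of_eLpNorm_le {m σ S : ℝ} (hS : 0 ≤ S) {u : ℝ → ℂ} (hu : Integrable u)
    (h : eLpNorm (fun k => Real.sqrt (gevreyWeight m σ k) • fHat u k) 2 volume ≤
      ENNReal.ofReal S) :
    MemGevrey m σ u ∧ gevreyNorm m σ u ≤ S := by
  have hmem : MemGevrey m σ u := by
    refine memGevrey_iff.2 ⟨hu, ?_⟩
    rw [gevreyEnergy_eq_eLpNorm_sq]
    exact ENNReal.pow_lt_top (h.trans_lt ENNReal.ofReal_lt_top)
  rw [hmem.eLpNorm_eq] at h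
  exact ⟨hmem, (ENNReal.ofReal_le_ofReal_iff hS).1 h⟩

theorem hasSum_fHat {f : ℕ → ℝ → ℂ} {U : ℝ → ℂ} (hf : ∀ n, Integrable (f n))
    (hsum : Summable fun n => ∫ x, ‖f n x‖) (hU : ∀ x, HasSum (fun n => f n x) (U x)) (k : ℝ) :
    HasSum (fun n => fHat (f n) k) (fHat U k) := by
  have hn (x : ℝ) : ‖Complex.exp (-(Complex.I * k * x))‖ = 1 := by
    rw [show -(Complex.I * k * x) = ((-(k * x) : ℝ) : ℂ) * Complex.I by push_cast; ring,
      Complex.norm_exp_ofReal_mul_I]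
  have h := hasSum_integral_of_summable_integral_norm (μ := volume)
    (F := fun n (x : ℝ) => Complex.exp (-(Complex.I * k * x)) • f n x)
    (fun n => (hf n).bdd_mul (c := 1) (Continuous.aestronglyMeasurable (by fun_prop))
      (.of_forall fun x => (hn x).le))
    (by simpa only [norm_smul, hn, one_mul] using hsum)
  have h2 : (fun x : ℝ => ∑' n, Complex.exp (-(Complex.I * k * x)) • f n x) =
      fun x : ℝ => Complex.exp (-(Complex.I * k * x)) • U x :=
    funext fun x => ((hU x).const_smul _).tsum_eq
  rw [h2] at h
  exact h.const_smul _

theorem memGevrey_of_hasSum {m σ : ℝ} {f : ℕ → ℝ → ℂ} {U : ℝ → ℂ}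
    (hf : ∀ n, MemGevrey m σ (f n)) (hint : Integrable U)
    (hsum : Summable fun n => ∫ x, ‖f n x‖) (hU : ∀ x, HasSum (fun n => f n x) (U x))
    (hnorm : Summable fun n => gevreyNorm m σ (f n)) :
    MemGevrey m σ U ∧ gevreyNorm m σ U ≤ ∑' n, gevreyNorm m σ (f n) := by
  have hpos : ∀ n, 0 ≤ gevreyNorm m σ (f n) := fun n => Real.sqrt_nonneg _
  have hw := continuous_gevreyWeight m σ
  have hmeas (n : ℕ) : AEStronglyMeasurable
      (fun k => Real.sqrt (gevreyWeight m σ k) • fHat (f n) k) volume := by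
    have := continuous_fHat (hf n).1
    exact Continuous.aestronglyMeasurable (by fun_prop)
  refine memGevrey_of_eLpNorm_le (tsum_nonneg hpos) hint ?_
  refine (Lp.eLpNorm_lim_le_liminf_eLpNorm
    (f := fun N => ∑ n ∈ Finset.range N,
      fun k => Real.sqrt (gevreyWeight m σ k) • fHat (f n) k)
    (fun N => Finset.aestronglyMeasurable_sum _ fun n _ => hmeas n) _
    (.of_forall fun k => ?_)).trans ?_
  · simp_rw [Finset.sum_apply]
    exact ((hasSum_fHat (fun n => (hf n).1) hsum hU k).const_smul _).tendsto_sum_nat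
  · refine Filter.liminf_le_of_le (by isBoundedDefault) fun b hb => ?_
    obtain ⟨N, hN⟩ := hb.exists
    refine hN.trans ((eLpNorm_sum_le (fun n _ => hmeas n) one_le_two).trans ?_)
    simp_rw [fun n => (hf n).eLpNorm_eq]
    rw [← ENNReal.ofReal_sum_of_nonneg fun n _ => hpos n]
    exact ENNReal.ofReal_le_ofReal (hnorm.sum_le_tsum _ fun n _ => hpos n)

/-- The series `∑ bₙ zⁿ⁺¹`. -/
noncomputable def shiftedSeries (b : ℕ → ℝ) (z : ℂ) : ℂ := ∑' n, (b n : ℂ) * z ^ (n + 1)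

theorem differentiable_shiftedSeries {b : ℕ → ℝ}
    (hb : ∀ R : ℝ, 0 ≤ R → Summable fun n => ‖b n‖ * R ^ (n + 1)) :
    Differentiable ℂ (shiftedSeries b) := by
  intro z
  have hR : (0 : ℝ) ≤ ‖z‖ + 1 := by positivity
  refine (Complex.differentiableOn_tsum_of_summable_norm (hb _ hR) (U := Metric.ball 0 (‖z‖ + 1))
    (F := fun n z => (b n : ℂ) * z ^ (n + 1)) (fun n => by fun_prop) Metric.isOpen_ball
    fun n w hw => ?_).differentiableAt (Metric.isOpen_ball.mem_nhds (by simp))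
  rw [norm_mul, norm_pow, Complex.norm_real]
  have : ‖w‖ ≤ ‖z‖ + 1 := by simpa using (mem_ball_zero_iff.1 hw).le
  gcongr

theorem shiftedSeries_ofReal (b : ℕ → ℝ) (x : ℝ) :
    shiftedSeries b x = ((∑' n, b n * x ^ (n + 1) : ℝ) : ℂ) := by
  rw [shiftedSeries, Complex.ofReal_tsum]
  simp

/-- For every entire function `φ` with `φ(0) = 0` and every `m > 1/2` there is
an entire function `φₘ`, real-valued and monotonically increasing on `[0,∞)` with `φₘ(0) = 0`,
such that `‖φ(u)‖_{G^m_σ} ≤ φₘ(‖u‖_{G^m_σ})` for all `σ ≥ 0` and `u ∈ G^m_σ`. -/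
theorem gevrey_composition (φ : ℂ → ℂ) (hφ : ∀ z : ℂ, AnalyticAt ℂ φ z) (hφ0 : φ 0 = 0)
    (m : ℝ) (hm : 1 / 2 < m) :
    ∃ φm : ℂ → ℂ,
      (∀ z : ℂ, AnalyticAt ℂ φm z) ∧
      (∀ x : ℝ, 0 ≤ x → (φm x).im = 0) ∧
      MonotoneOn (fun x : ℝ => (φm x).re) (Set.Ici 0) ∧
      φm 0 = 0 ∧
      ∀ σ : ℝ, 0 ≤ σ → ∀ u : ℝ → ℂ, MemGevrey m σ u →
        MemGevrey m σ (fun x => φ (u x)) ∧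
        gevreyNorm m σ (fun x => φ (u x)) ≤ (φm ((gevreyNorm m σ u : ℝ) : ℂ)).re := by
  obtain ⟨K, hK, hpow⟩ := MemGevrey.pow hm
  have hK0 : 0 ≤ K := zero_le_one.trans hK
  obtain ⟨a, ha⟩ : ∃ a : ℕ → ℂ, ∀ z, HasSum (fun n => a n * z ^ (n + 1)) (φ z) := by
    refine ⟨fun n => ((n + 1).factorial : ℂ)⁻¹ * iteratedDeriv (n + 1) φ 0, fun z => ?_⟩
    have h := Complex.hasSum_taylorSeries_of_entire
      (fun z => (hφ z).differentiableAt) 0 z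
    rw [← hasSum_nat_add_iff' 1] at h
    simp only [Finset.range_one, Finset.sum_singleton, iteratedDeriv_zero, hφ0, sub_zero,
      smul_zero] at h
    refine h.congr_fun fun n => ?_
    simp only [smul_eq_mul]
    ring
  have hasum (R : ℝ) (hR : 0 ≤ R) : Summable fun n => ‖a n‖ * R ^ (n + 1) := by
    simpa [abs_of_nonneg hR] using (ha R).summable.norm
  set b : ℕ → ℝ := fun n => ‖a n‖ * K ^ n with hb
  have hb0 (n : ℕ) : 0 ≤ b n := by positivity
  have hbsum (R : ℝ) (hR : 0 ≤ R) : Summable fun n => b n * R ^ (n + 1) := by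
    refine (hasum (K * R) (by positivity)).of_nonneg_of_le (fun n => by positivity) fun n => ?_
    have : K ^ n ≤ K ^ (n + 1) := pow_le_pow_right₀ hK n.le_succ
    calc ‖a n‖ * K ^ n * R ^ (n + 1) ≤ ‖a n‖ * K ^ (n + 1) * R ^ (n + 1) := by gcongr
      _ = _ := by ring
  have hdiff : Differentiable ℂ (shiftedSeries b) :=
    differentiable_shiftedSeries fun R hR => by
      simpa only [Real.norm_of_nonneg (hb0 _)] using hbsum R hR
  refine ⟨shiftedSeries b, fun z => hdiff.analyticAt z, fun x _ => ?_, ?_, ?_, ?_⟩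
  · rw [shiftedSeries_ofReal, Complex.ofReal_im]
  · intro x hx y hy hxy
    simp only [shiftedSeries_ofReal, Complex.ofReal_re]
    have hx : 0 ≤ x := hx
    refine (hbsum x hx).tsum_le_tsum (fun n => ?_) (hbsum y hy)
    have := hb0 n
    gcongr
  · simp [shiftedSeries]
  intro σ hσ u hu
  rw [shiftedSeries_ofReal, Complex.ofReal_re]
  have hN0 : 0 ≤ gevreyNorm m σ u := Real.sqrt_nonneg _
  have hbd := norm_le_integral_norm_fHat hu.1 (hu.integrable_fHat hm hσ)
  have hM0 : 0 ≤ (Real.sqrt (2 * Real.pi))⁻¹ * ∫ l : ℝ, ‖fHat u l‖ := by positivity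
  set M := (Real.sqrt (2 * Real.pi))⁻¹ * ∫ l : ℝ, ‖fHat u l‖
  have hMsum : Summable fun n => ‖a n‖ * M ^ n := by
    refine (hasum (M + 1) (by positivity)).of_nonneg_of_le (fun n => by positivity) fun n => ?_
    gcongr
    calc M ^ n ≤ (M + 1) ^ n := by gcongr; linarith
      _ ≤ (M + 1) ^ (n + 1) := pow_le_pow_right₀ (by linarith) n.le_succ
  have hterm {x : ℝ} (hx : ‖u x‖ ≤ M) (n : ℕ) :
      ‖a n * u x ^ (n + 1)‖ ≤ ‖a n‖ * M ^ n * ‖u x‖ := by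
    rw [norm_mul, norm_pow, pow_succ, mul_assoc]
    gcongr
  have hint : Integrable fun x => φ (u x) := by
    have hφc : Continuous φ := continuous_iff_continuousAt.2 fun z => (hφ z).continuousAt
    refine (hu.1.norm.const_mul (∑' n, ‖a n‖ * M ^ n)).mono'
      (hφc.comp_aestronglyMeasurable hu.1.aestronglyMeasurable) ?_
    filter_upwards [hbd] with x hx
    exact (ha (u x)).norm_le_of_bounded (hMsum.hasSum.mul_right _) (hterm hx)
  have hmem (n : ℕ) : MemGevrey m σ fun x => a n * u x ^ (n + 1) :=
    (hpow σ hσ u hu n).1.const_mul _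
  have hnorm (n : ℕ) :
      gevreyNorm m σ (fun x => a n * u x ^ (n + 1)) ≤ b n * gevreyNorm m σ u ^ (n + 1) := by
    rw [gevreyNorm_const_mul, hb, mul_assoc]
    gcongr
    exact (hpow σ hσ u hu n).2
  have hL1 : Summable fun n => ∫ x, ‖a n * u x ^ (n + 1)‖ := by
    refine (hMsum.mul_right (∫ x, ‖u x‖)).of_nonneg_of_le
      (fun n => integral_nonneg fun x => norm_nonneg _) fun n => ?_
    rw [← integral_const_mul]
    refine integral_mono_ae (hmem n).1.norm (hu.1.norm.const_mul _) ?_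
    filter_upwards [hbd] with x hx using hterm hx n
  have hsum : Summable fun n => gevreyNorm m σ (fun x => a n * u x ^ (n + 1)) :=
    (hbsum _ hN0).of_nonneg_of_le (fun n => Real.sqrt_nonneg _) hnorm
  obtain ⟨h1, h2⟩ := memGevrey_of_hasSum hmem hint hL1 (fun x => ha (u x)) hsum
  exact ⟨h1, h2.trans (hsum.tsum_le_tsum hnorm (hbsum _ hN0))⟩
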